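/- The probit loss L(t) = −log Φ(t) is twice differentiable on ℝ with L′(t) = −φ(t)/Φ(t), and its second derivative satisfies 0 < L″(t) ≤ 1 for every t ∈ ℝ. In particular, L is strictly convex on ℝ. -/

import Mathlib

/-- The density `φ` of the standard normal distribution `N(0,1)`. -/
noncomputable def stdGaussPDF (t : ℝ) : ℝ := (Real.sqrt (2 * Real.pi))⁻¹ * Real.exp (-t ^ 2 / 2)

/-- The cumulative distribution function `Φ` of the standard normal distribution `N(0,1)`. -/
noncomputable def stdGaussCDF (t : ℝ) : ℝ := ∫ x in Set.Iic t, stdGaussPDF x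

/-- The probit loss `L(t) = −log Φ(t)`. -/
noncomputable def probitLoss (t : ℝ) : ℝ := -Real.log (stdGaussCDF t)

open MeasureTheory Set Filter Topology

lemma stdGaussPDF_pos (t : ℝ) : 0 < stdGaussPDF t := by
  unfold stdGaussPDF
  positivity

lemma hasDerivAt_stdGaussPDF (t : ℝ) : HasDerivAt stdGaussPDF (-t * stdGaussPDF t) t := by
  have h : HasDerivAt (fun x : ℝ => -x ^ 2 / 2) (-t) t :=
    (((hasDerivAt_pow 2 t).neg).div_const 2).congr_deriv (by norm_num; ring)
  exact (h.exp.const_mul (Real.sqrt (2 * Real.pi))⁻¹).congr_deriv (by unfold stdGaussPDF; ring)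

lemma continuous_stdGaussPDF : Continuous stdGaussPDF :=
  continuous_iff_continuousAt.2 fun t => (hasDerivAt_stdGaussPDF t).continuousAt

lemma integrable_pow_mul_stdGaussPDF (n : ℕ) :
    Integrable (fun x : ℝ => x ^ n * stdGaussPDF x) := by
  have h := (integrable_rpow_mul_exp_neg_mul_sq (b := 1 / 2) (by norm_num) (s := n)
    (lt_of_lt_of_le (by norm_num) n.cast_nonneg)).const_mul (Real.sqrt (2 * Real.pi))⁻¹
  refine h.congr (Eventually.of_forall fun x => ?_)
  simp only [stdGaussPDF, Real.rpow_natCast]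
  rw [show -(1 / 2) * x ^ 2 = -x ^ 2 / 2 by ring]
  ring

lemma integrable_stdGaussPDF : Integrable stdGaussPDF := by
  simpa using integrable_pow_mul_stdGaussPDF 0

lemma integrable_mul_stdGaussPDF : Integrable (fun x : ℝ => x * stdGaussPDF x) := by
  simpa using integrable_pow_mul_stdGaussPDF 1

lemma integral_Iic_eq_of_hasDerivAt_of_integrable {f f' : ℝ → ℝ}
    (hf : ∀ x, HasDerivAt f (f' x) x) (hint : Integrable f) (hint' : Integrable f') (t : ℝ) :
    ∫ x in Iic t, f' x = f t := by
  have h0 : Tendsto f atBot (𝓝 0) :=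
    tendsto_zero_of_hasDerivAt_of_integrableOn_Iic (a := t) (fun x _ => hf x)
      hint'.integrableOn hint.integrableOn
  simpa using integral_Iic_of_hasDerivAt_of_tendsto' (fun x _ => hf x) hint'.integrableOn h0

lemma integral_Iic_mul_stdGaussPDF (t : ℝ) :
    ∫ x in Iic t, x * stdGaussPDF x = -stdGaussPDF t :=
  integral_Iic_eq_of_hasDerivAt_of_integrable (f := fun x => -stdGaussPDF x)
    (fun x => (hasDerivAt_stdGaussPDF x).neg.congr_deriv (by ring))
    integrable_stdGaussPDF.neg integrable_mul_stdGaussPDF t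

lemma integral_Iic_sq_mul_stdGaussPDF (t : ℝ) :
    ∫ x in Iic t, x ^ 2 * stdGaussPDF x = stdGaussCDF t - t * stdGaussPDF t := by
  have h : ∫ x in Iic t, (x ^ 2 * stdGaussPDF x - stdGaussPDF x) = -(t * stdGaussPDF t) :=
    integral_Iic_eq_of_hasDerivAt_of_integrable (f := fun x => -(x * stdGaussPDF x))
      (fun x => ((hasDerivAt_id x).mul (hasDerivAt_stdGaussPDF x)).neg.congr_deriv
        (by simp only [id, Pi.sub_apply]; ring))
      integrable_mul_stdGaussPDF.neg
      ((integrable_pow_mul_stdGaussPDF 2).sub integrable_stdGaussPDF) t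
  rw [integral_sub (integrable_pow_mul_stdGaussPDF 2).integrableOn
    integrable_stdGaussPDF.integrableOn] at h
  unfold stdGaussCDF
  linarith

lemma setIntegral_Iic_pos {f : ℝ → ℝ} {t : ℝ} (hf : IntegrableOn f (Iic t))
    (hpos : ∀ x < t, 0 < f x) : 0 < ∫ x in Iic t, f x := by
  rw [integral_Iic_eq_integral_Iio, setIntegral_pos_iff_support_of_nonneg_ae
    ((ae_restrict_mem measurableSet_Iio).mono fun x hx => (hpos x hx).le)
    (hf.mono_set Iio_subset_Iic_self)]
  have hsub : Iio t ⊆ Function.support f := fun x hx => (hpos x hx).ne'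
  rw [inter_eq_self_of_subset_right hsub]
  simp

lemma stdGaussCDF_pos (t : ℝ) : 0 < stdGaussCDF t :=
  setIntegral_Iic_pos integrable_stdGaussPDF.integrableOn fun x _ => stdGaussPDF_pos x

lemma hasDerivAt_stdGaussCDF (t : ℝ) : HasDerivAt stdGaussCDF (stdGaussPDF t) t := by
  have h : stdGaussCDF = fun u => stdGaussCDF 0 + ∫ x in (0 : ℝ)..u, stdGaussPDF x := by
    funext u
    have := intervalIntegral.integral_Iic_sub_Iic (μ := volume) (f := stdGaussPDF) (a := 0) (b := u)
      integrable_stdGaussPDF.integrableOn integrable_stdGaussPDF.integrableOn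
    unfold stdGaussCDF
    linarith
  rw [h]
  exact (continuous_stdGaussPDF.integral_hasStrictDerivAt 0 t).hasDerivAt.const_add _

/-- A form of the Mills ratio inequality. -/
lemma mul_stdGaussCDF_add_stdGaussPDF_pos (t : ℝ) :
    0 < t * stdGaussCDF t + stdGaussPDF t := by
  have hint : IntegrableOn (fun x => t * stdGaussPDF x - x * stdGaussPDF x) (Iic t) :=
    ((integrable_stdGaussPDF.const_mul t).sub integrable_mul_stdGaussPDF).integrableOn
  have h := setIntegral_Iic_pos hint fun x hx => by
    rw [← sub_mul]
    exact mul_pos (sub_pos.2 hx) (stdGaussPDF_pos x)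
  rw [integral_sub (integrable_stdGaussPDF.const_mul t).integrableOn
    integrable_mul_stdGaussPDF.integrableOn, integral_const_mul,
    integral_Iic_mul_stdGaussPDF] at h
  unfold stdGaussCDF
  linarith

/-- The second moment about `m` of the normal distribution restricted to `(-∞, t]`. -/
lemma integral_Iic_sub_sq_mul_stdGaussPDF (m t : ℝ) :
    ∫ x in Iic t, (x - m) ^ 2 * stdGaussPDF x =
      stdGaussCDF t - t * stdGaussPDF t + 2 * m * stdGaussPDF t + m ^ 2 * stdGaussCDF t := by
  have hexp : ∀ x, (x - m) ^ 2 * stdGaussPDF x =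
      x ^ 2 * stdGaussPDF x - 2 * m * (x * stdGaussPDF x) + m ^ 2 * stdGaussPDF x :=
    fun x => by ring
  have h1 := (integrable_mul_stdGaussPDF.const_mul (2 * m)).integrableOn (s := Iic t)
  have h2 := (integrable_pow_mul_stdGaussPDF 2).integrableOn (s := Iic t)
  have h3 : IntegrableOn
      (fun x => x ^ 2 * stdGaussPDF x - 2 * m * (x * stdGaussPDF x)) (Iic t) := h2.sub h1
  simp_rw [hexp]
  rw [integral_add h3 (integrable_stdGaussPDF.const_mul _).integrableOn,
    integral_sub h2 h1, integral_const_mul, integral_const_mul,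
    integral_Iic_mul_stdGaussPDF, integral_Iic_sq_mul_stdGaussPDF]
  unfold stdGaussCDF
  ring

/-- The variance of the normal distribution conditioned on `(-∞, t]` is nonnegative. -/
lemma stdGaussPDF_mul_le_stdGaussCDF_sq (t : ℝ) :
    stdGaussPDF t * (t * stdGaussCDF t + stdGaussPDF t) ≤ stdGaussCDF t ^ 2 := by
  have hpos := stdGaussCDF_pos t
  have h : 0 ≤ ∫ x in Iic t, (x - -(stdGaussPDF t / stdGaussCDF t)) ^ 2 * stdGaussPDF x :=
    integral_nonneg fun x => mul_nonneg (sq_nonneg _) (stdGaussPDF_pos x).le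
  rw [integral_Iic_sub_sq_mul_stdGaussPDF] at h
  have h' := mul_nonneg h hpos.le
  field_simp at h'
  linarith

lemma hasDerivAt_probitLoss (t : ℝ) :
    HasDerivAt probitLoss (-(stdGaussPDF t / stdGaussCDF t)) t :=
  ((hasDerivAt_stdGaussCDF t).log (stdGaussCDF_pos t).ne').neg

lemma hasDerivAt_deriv_probitLoss (t : ℝ) :
    HasDerivAt (deriv probitLoss)
      (stdGaussPDF t * (t * stdGaussCDF t + stdGaussPDF t) / stdGaussCDF t ^ 2) t := by
  have h : deriv probitLoss = fun t => -(stdGaussPDF t / stdGaussCDF t) :=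
    funext fun t => (hasDerivAt_probitLoss t).deriv
  rw [h]
  exact ((hasDerivAt_stdGaussPDF t).div (hasDerivAt_stdGaussCDF t)
    (stdGaussCDF_pos t).ne').neg.congr_deriv (by ring)

lemma deriv_deriv_probitLoss_pos (t : ℝ) : 0 < deriv (deriv probitLoss) t := by
  rw [(hasDerivAt_deriv_probitLoss t).deriv]
  exact div_pos (mul_pos (stdGaussPDF_pos t) (mul_stdGaussCDF_add_stdGaussPDF_pos t))
    (pow_pos (stdGaussCDF_pos t) 2)

lemma deriv_deriv_probitLoss_le_one (t : ℝ) : deriv (deriv probitLoss) t ≤ 1 := by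
  rw [(hasDerivAt_deriv_probitLoss t).deriv]
  exact div_le_one_of_le₀ (stdGaussPDF_mul_le_stdGaussCDF_sq t) (sq_nonneg _)

/-- The probit loss `L(t) = −log Φ(t)` is twice differentiable on `ℝ` with
`L′(t) = −φ(t)/Φ(t)` and `0 < L″(t) ≤ 1` for all `t`; in particular `L` is strictly convex. -/
theorem probitLoss_deriv_and_bounds :
    (∀ t : ℝ, HasDerivAt probitLoss (-(stdGaussPDF t / stdGaussCDF t)) t) ∧
    (∀ t : ℝ, DifferentiableAt ℝ (deriv probitLoss) t) ∧
    (∀ t : ℝ, 0 < deriv (deriv probitLoss) t ∧ deriv (deriv probitLoss) t ≤ 1) ∧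
    StrictConvexOn ℝ Set.univ probitLoss := by
  refine ⟨hasDerivAt_probitLoss, fun t => (hasDerivAt_deriv_probitLoss t).differentiableAt,
    fun t => ⟨deriv_deriv_probitLoss_pos t, deriv_deriv_probitLoss_le_one t⟩, ?_⟩
  exact strictConvexOn_of_deriv2_pos' convex_univ
    (fun t _ => (hasDerivAt_probitLoss t).continuousAt.continuousWithinAt)
    fun t _ => deriv_deriv_probitLoss_pos t
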